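/- Let G = A_n be the alternating group of degree n. Then the order of the finite abelian group ℤ_{ℚ(G)}/ℤ[G] is odd. -/

import Mathlib

open CategoryTheory Module Pointwise
open scoped MatrixGroups

/-- The set of all values `χ(g)` of irreducible complex characters `χ` of `G`. -/
noncomputable def charValues (G : Type) [Group G] : Set ℂ :=
  {z : ℂ | ∃ V : FDRep ℂ G, Simple V ∧ ∃ g : G, V.character g = z}

/-- `ℚ(G)`, the field of character values of `G`, as a subfield of `ℂ`. -/
noncomputable def charField (G : Type) [Group G] : Subfield ℂ :=
  Subfield.closure (charValues G)

/-- `ℤ[G]`, the subring of `ℂ` generated by the character values of `G`. -/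
noncomputable def charRing (G : Type) [Group G] : Subring ℂ :=
  Subring.closure (charValues G)

/-- The ring of integers of a subfield `K` of `ℂ`, i.e. the elements of `K` integral
over `ℤ`, as a subring of `ℂ`. -/
noncomputable def ringOfIntIn (K : Subfield ℂ) : Subring ℂ :=
  (integralClosure ℤ ℂ).toSubring ⊓ K.toSubring

/-- The additive quotient group `ℤ_{ℚ(G)}/ℤ[G]`. -/
noncomputable def charQuot (G : Type) [Group G] :=
  ↥((ringOfIntIn (charField G)).toAddSubgroup) ⧸
    ((charRing G).toAddSubgroup.addSubgroupOf (ringOfIntIn (charField G)).toAddSubgroup)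

noncomputable instance (G : Type) [Group G] : AddCommGroup (charQuot G) := by
  unfold charQuot; infer_instance

/-- The `m`-th cyclotomic field `ℚ(ζ_m)`, as the subfield of `ℂ` generated by the
`m`-th roots of unity. -/
noncomputable def cycField (m : ℕ) : Subfield ℂ :=
  Subfield.closure {z : ℂ | z ^ m = 1}

/-- The set of values `χ(g)` at a fixed `g` of irreducible complex characters `χ` of `G`. -/
noncomputable def charValuesAt {G : Type} [Group G] (g : G) : Set ℂ :=
  {z : ℂ | ∃ V : FDRep ℂ G, Simple V ∧ V.character g = z}

/-- `ℚ(g)`, the subfield of `ℂ` generated by one column of the character table. -/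
noncomputable def charFieldAt {G : Type} [Group G] (g : G) : Subfield ℂ :=
  Subfield.closure (charValuesAt g)

/-- `ℤ[g]`, the subring of `ℂ` generated by one column of the character table. -/
noncomputable def charRingAt {G : Type} [Group G] (g : G) : Subring ℂ :=
  Subring.closure (charValuesAt g)


theorem Equiv.Perm.isConj_pow_of_coprime {α : Type*} [Fintype α] [DecidableEq α]
    (g : Equiv.Perm α) {j : ℕ} (hj : j.Coprime (orderOf g)) : IsConj g (g ^ j) := by
  induction g using Equiv.Perm.cycle_induction_on with
  | base_one => simp
  | base_cycles σ hσ =>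
    exact (hσ.isConj_iff ((hσ.pow_iff).2 hj)).2 (by rw [support_pow_coprime hj])
  | induction_disjoint σ τ hd _ hσ hτ =>
    rw [hd.orderOf] at hj
    rw [hd.commute.mul_pow]
    exact hd.isConj_mul (hσ (hj.coprime_dvd_right (Nat.dvd_lcm_left _ _)))
      (hτ (hj.coprime_dvd_right (Nat.dvd_lcm_right _ _))) (hd.pow_disjoint_pow j j)

/-- In an alternating group, an element of even order is conjugate to all the other generators of
the cyclic group it generates. -/
theorem alternatingGroup.isConj_pow_of_coprime {α : Type*} [Fintype α] [DecidableEq α]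
    (g : alternatingGroup α) (hg : Even (orderOf g)) {j : ℕ} (hj : j.Coprime (orderOf g)) :
    IsConj g (g ^ j) := by
  have hodd : ¬ Subgroup.centralizer {(g : Equiv.Perm α)} ≤ alternatingGroup α := by
    intro h
    rw [← Subgroup.orderOf_coe, ← Equiv.Perm.lcm_cycleType, ← Nat.not_odd_iff_even] at hg
    refine hg (Multiset.induction_on (p := fun s => (∀ i ∈ s, Odd i) → Odd s.lcm)
      (g : Equiv.Perm α).cycleType (by simp) ?_
      (Equiv.Perm.OnCycleFactors.odd_of_centralizer_le_alternatingGroup h))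
    intro a s ih hs
    rw [Multiset.lcm_cons]
    exact ((hs a (by simp)).mul (ih fun i hi => hs i (by simp [hi]))).of_dvd_nat
      (Nat.lcm_dvd_mul _ _)
  obtain ⟨τ, hτ, hτ'⟩ := SetLike.not_le_iff_exists.1 hodd
  rw [Subgroup.mem_centralizer_singleton_iff] at hτ
  rw [← Subgroup.orderOf_coe] at hj
  obtain ⟨σ, hσ⟩ := isConj_iff.1 (Equiv.Perm.isConj_pow_of_coprime (g : Equiv.Perm α) hj)
  rw [isConj_iff]
  by_cases h : σ ∈ alternatingGroup α
  · exact ⟨⟨σ, h⟩, Subtype.ext hσ⟩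
  · rw [Equiv.Perm.mem_alternatingGroup] at h hτ'
    refine ⟨⟨σ * τ, ?_⟩, Subtype.ext ?_⟩
    · rw [Equiv.Perm.mem_alternatingGroup, map_mul, (Int.units_eq_one_or _).resolve_left h,
        (Int.units_eq_one_or _).resolve_left hτ']
      rfl
    · simp only [Subgroup.coe_mul, Subgroup.coe_inv, Subgroup.coe_pow, ← hσ, mul_inv_rev]
      calc σ * τ * (g : Equiv.Perm α) * (τ⁻¹ * σ⁻¹) = σ * (τ * g) * τ⁻¹ * σ⁻¹ := by group
        _ = _ := by rw [hτ]; group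

open LinearMap in
theorem LinearMap.trace_map_comp_comm {K V : Type*} [Field K] [AddCommGroup V] [Module K V]
    [FiniteDimensional K V] (f : V →ₗ[K] V) :
    trace K _ (TensorProduct.map f f ∘ₗ (TensorProduct.comm K V V).toLinearMap) =
      trace K V (f * f) := by
  let b := Module.finBasis K V
  rw [trace_eq_matrix_trace K (b.tensorProduct b), trace_eq_matrix_trace K b,
    LinearMap.toMatrix_mul]
  simp only [Matrix.trace, Matrix.diag, Matrix.mul_apply, Fintype.sum_prod_type]
  refine Finset.sum_congr rfl fun i _ => Finset.sum_congr rfl fun j _ => ?_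
  simp [LinearMap.toMatrix_apply, Module.Basis.tensorProduct_apply, mul_comm]

open LinearMap in
theorem LinearMap.exists_trace_pow_eq_sum {V : Type*} [AddCommGroup V] [Module ℂ V]
    [FiniteDimensional ℂ V] (f : Module.End ℂ V) {m : ℕ} (hm : m ≠ 0) (hf : f ^ m = 1) :
    ∃ (s : Finset ℂ) (d : ℂ → ℕ), (∀ μ ∈ s, μ ^ m = 1) ∧
      ∀ j, trace ℂ V (f ^ j) = ∑ μ ∈ s, (d μ : ℂ) * μ ^ j := by
  have hss : f.IsSemisimple := by
    refine Module.End.isSemisimple_of_squarefree_aeval_eq_zero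
      (p := Polynomial.X ^ m - Polynomial.C 1) ?_ (by simp [hf])
    exact (Polynomial.separable_X_pow_sub_C (1 : ℂ) (by exact_mod_cast hm) one_ne_zero).squarefree
  have hint : DirectSum.IsInternal f.eigenspace := by
    rw [DirectSum.isInternal_submodule_iff_iSupIndep_and_iSup_eq_top]
    refine ⟨f.eigenspaces_iSupIndep, ?_⟩
    rw [← Module.End.iSup_maxGenEigenspace_eq_top f]
    simp [hss.isFinitelySemisimple.maxGenEigenspace_eq_eigenspace]
  have hfin : {μ | f.eigenspace μ ≠ ⊥}.Finite :=
    WellFoundedGT.finite_ne_bot_of_iSupIndep f.eigenspaces_iSupIndep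
  have key : ∀ (j : ℕ) (μ : ℂ) (v : V), v ∈ f.eigenspace μ → (f ^ j) v = μ ^ j • v := by
    intro j μ v hv
    rw [Module.End.mem_eigenspace_iff] at hv
    induction j with
    | zero => simp
    | succ j ih => rw [pow_succ, Module.End.mul_apply, hv, map_smul, ih, smul_smul, pow_succ,
        mul_comm]
  refine ⟨hfin.toFinset, fun μ => Module.finrank ℂ (f.eigenspace μ), ?_, ?_⟩
  · intro μ hμ
    rw [Set.Finite.mem_toFinset] at hμ
    obtain ⟨v, hv, hv0⟩ := (Submodule.ne_bot_iff _).1 hμ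
    have h := key m μ v hv
    rw [hf, Module.End.one_apply] at h
    exact smul_left_injective ℂ hv0 (by simpa using h.symm)
  · intro j
    have hmaps : ∀ μ, Set.MapsTo (f ^ j) (f.eigenspace μ) (f.eigenspace μ) := fun μ v hv => by
      rw [SetLike.mem_coe, key j μ v hv]
      exact Submodule.smul_mem _ _ hv
    rw [trace_eq_sum_trace_restrict' hint hfin hmaps]
    refine Finset.sum_congr rfl fun μ _ => ?_
    have : (f ^ j).restrict (hmaps μ) = μ ^ j • LinearMap.id :=
      LinearMap.ext fun v => Subtype.ext (key j μ v v.2)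
    rw [this, map_smul, trace_id, smul_eq_mul, mul_comm]

/-- A sum of `m`-th roots of unity fixed by all the power maps `μ ↦ μ ^ j`, `j` coprime to `m`,
is an integer. -/
theorem exists_int_eq_sum_of_forall_coprime {m : ℕ} (hm : m ≠ 0) (K : Type*) [Field K]
    [Algebra ℚ K] [IsCyclotomicExtension {m} ℚ K] (φ : K →ₐ[ℚ] ℂ) {s : Finset ℂ} {d : ℂ → ℕ}
    (hs : ∀ μ ∈ s, μ ^ m = 1)
    (h : ∀ j : ℕ, j.Coprime m → ∑ μ ∈ s, (d μ : ℂ) * μ ^ j = ∑ μ ∈ s, (d μ : ℂ) * μ) :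
    ∃ a : ℤ, ∑ μ ∈ s, (d μ : ℂ) * μ = a := by
  have : NeZero m := ⟨hm⟩
  let ζ : K := IsCyclotomicExtension.zeta m ℚ K
  have hζ : IsPrimitiveRoot ζ m := IsCyclotomicExtension.zeta_spec m ℚ K
  have hφζ : IsPrimitiveRoot (φ ζ) m := hζ.map_of_injective φ.injective
  have hpow : ∀ μ ∈ s, ∃ i, φ ζ ^ i = μ := fun μ hμ => by
    obtain ⟨i, _, hi⟩ := hφζ.eq_pow_of_pow_eq_one (hs μ hμ)
    exact ⟨i, hi⟩
  choose! i hi using hpow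
  have hz : ∀ j, φ (∑ μ ∈ s, (d μ : K) * (ζ ^ j) ^ i μ) = ∑ μ ∈ s, (d μ : ℂ) * μ ^ j := by
    intro j
    simp only [map_sum, map_mul, map_natCast, map_pow]
    refine Finset.sum_congr rfl fun μ hμ => ?_
    rw [pow_right_comm, hi μ hμ]
  have hz1 := hz 1
  simp only [pow_one] at hz1
  have := IsCyclotomicExtension.finiteDimensional {m} ℚ K
  have : IsGalois ℚ K := IsCyclotomicExtension.isGalois {m} ℚ K
  have hfix : ∑ μ ∈ s, (d μ : K) * ζ ^ i μ ∈ (⊥ : IntermediateField ℚ K) := by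
    rw [IsGalois.mem_bot_iff_fixed]
    intro σ
    obtain ⟨j, _, hj, hσ⟩ := (hζ.isPrimitiveRoot_iff).1 (hζ.map_of_injective σ.injective)
    refine φ.injective (?_ : φ _ = φ _)
    rw [hz1, ← h j hj, ← hz j, hσ]
    simp
  obtain ⟨q, hq⟩ := IntermediateField.mem_bot.1 hfix
  have hint : IsIntegral ℤ (algebraMap ℚ ℂ q) := by
    rw [← φ.commutes, hq, hz1]
    exact IsIntegral.sum _ fun μ hμ => (isIntegral_algebraMap (R := ℤ) (x := (d μ : ℤ))).mul
      (IsIntegral.of_pow (Nat.pos_of_ne_zero hm) (by rw [hs μ hμ]; exact isIntegral_one))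
  rw [isIntegral_algebraMap_iff (algebraMap ℚ ℂ).injective] at hint
  obtain ⟨a, ha⟩ := IsIntegrallyClosed.isIntegral_iff.1 hint
  refine ⟨a, ?_⟩
  rw [← hz1, ← hq, φ.commutes, ← ha]
  simp

namespace Representation

variable {G : Type} [Group G]

/-- The character of every finite-dimensional complex representation takes values in `ℤ[G]`. -/
theorem character_mem_charRing [Finite G] {V : Type} [AddCommGroup V] [Module ℂ V]
    [FiniteDimensional ℂ V] (ρ : Representation ℂ G V) (g : G) :
    ρ.character g ∈ charRing G := by
  induction h : Module.finrank ℂ V using Nat.strong_induction_on generalizing V with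
  | _ n ih =>
  subst h
  by_cases htriv : ∀ W : Subrepresentation ρ, W = ⊥ ∨ W = ⊤
  · rcases subsingleton_or_nontrivial V with hV | hV
    · have : ρ g = 0 := Subsingleton.elim _ _
      rw [character, this, map_zero]
      exact zero_mem _
    · have hne : (⊥ : Subrepresentation ρ) ≠ ⊤ := fun h =>
        bot_ne_top (congrArg Subrepresentation.toSubmodule h : (⊥ : Submodule ℂ V) = ⊤)
      have : Nontrivial (Subrepresentation ρ) := ⟨⊥, ⊤, hne⟩
      have hirr : IsIrreducible ρ := ⟨htriv⟩
      have := Fintype.ofFinite G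
      have hcard : (Nat.card G : ℂ) ≠ 0 := NeZero.ne _
      have := invertibleOfNonzero hcard
      have horth := char_orthonormal ρ ρ
      rw [if_pos ⟨Equiv.refl ρ⟩, inv_mul_eq_one₀ hcard] at horth
      have hsimple : Simple (FDRep.of ρ) :=
        (FDRep.simple_iff_char_is_norm_one _).2 horth.symm
      exact Subring.subset_closure ⟨FDRep.of ρ, hsimple, g, rfl⟩
  · push Not at htriv
    obtain ⟨W, hbot, htop⟩ := htriv
    obtain ⟨W', hW⟩ := exists_isCompl W
    have hc : IsCompl W.toSubmodule W'.toSubmodule := by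
      constructor
      · rw [disjoint_iff]
        exact congrArg Subrepresentation.toSubmodule hW.inf_eq_bot
      · rw [codisjoint_iff]
        exact congrArg Subrepresentation.toSubmodule hW.sup_eq_top
    have hsum : ρ.character g =
        W.toRepresentation.character g + W'.toRepresentation.character g := by
      let N : Bool → Submodule ℂ V := fun b => bif b then W.toSubmodule else W'.toSubmodule
      have hN : DirectSum.IsInternal N := by
        rw [DirectSum.isInternal_submodule_iff_isCompl N (i := true) (j := false) (by simp)
          (by ext b; cases b <;> simp)]
        exact hc
      have hmaps : ∀ b, Set.MapsTo (ρ g) (N b) (N b) := by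
        rintro (_ | _)
        · exact W'.apply_mem_toSubmodule g
        · exact W.apply_mem_toSubmodule g
      rw [character, LinearMap.trace_eq_sum_trace_restrict hN hmaps, Fintype.sum_bool]
      rfl
    have hlt : ∀ U : Subrepresentation ρ, U ≠ ⊤ →
        Module.finrank ℂ U.toSubmodule < Module.finrank ℂ V := fun U hU =>
      Submodule.finrank_lt fun h => hU (Subrepresentation.toSubmodule_injective h)
    have htop' : W' ≠ ⊤ := by
      rintro rfl
      exact hbot (by simpa using hW.inf_eq_bot)
    rw [hsum]
    exact add_mem (ih _ (hlt W htop) W.toRepresentation rfl)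
      (ih _ (hlt W' htop') W'.toRepresentation rfl)

open LinearMap in
theorem trace_mul_mem_charRing_of_isIdempotentElem [Finite G] {V : Type} [AddCommGroup V]
    [Module ℂ V] [FiniteDimensional ℂ V] (ρ : Representation ℂ G V) {e : Module.End ℂ V}
    (he : IsIdempotentElem e) (hcomm : ∀ g, Commute (ρ g) e) (g : G) :
    trace ℂ V (ρ g * e) ∈ charRing G := by
  let W : Subrepresentation ρ :=
    { toSubmodule := range e
      apply_mem_toSubmodule := by
        rintro h _ ⟨v, rfl⟩
        exact ⟨ρ h v, (LinearMap.congr_fun (hcomm h) v).symm⟩ }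
  have hfix : ∀ w ∈ range e, e w = w := by
    rintro _ ⟨v, rfl⟩
    exact LinearMap.congr_fun he v
  have : trace ℂ V (ρ g * e) = W.toRepresentation.character g := by
    have h1 : ρ g * e = (range e).subtype ∘ₗ (W.toRepresentation g ∘ₗ e.rangeRestrict) := rfl
    have h2 : (W.toRepresentation g ∘ₗ e.rangeRestrict) ∘ₗ (range e).subtype =
        W.toRepresentation g := by
      refine LinearMap.ext fun w => congrArg (W.toRepresentation g) (Subtype.ext (hfix w w.2))
    rw [h1, trace_comp_comm', h2]
    rfl
  rw [this]
  exact character_mem_charRing _ _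

open LinearMap in
/-- The difference is twice the character of the exterior square. -/
theorem exists_character_sq_sub_eq [Finite G] {V : Type} [AddCommGroup V] [Module ℂ V]
    [FiniteDimensional ℂ V] (ρ : Representation ℂ G V) (g : G) :
    ∃ r ∈ charRing G, ρ.character g ^ 2 - ρ.character (g ^ 2) = 2 * r := by
  let τ : Module.End ℂ (TensorProduct ℂ V V) := (_root_.TensorProduct.comm ℂ V V).toLinearMap
  have hτ : τ * τ = 1 := by
    refine TensorProduct.ext' fun x y => ?_
    simp [τ]
  let e : Module.End ℂ (TensorProduct ℂ V V) := (2⁻¹ : ℂ) • (1 - τ)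
  have he : IsIdempotentElem e := by
    have : (1 - τ) * (1 - τ) = (2 : ℂ) • (1 - τ) := by
      rw [mul_sub, sub_mul, sub_mul, hτ, two_smul, one_mul, one_mul, mul_one]
      abel
    simp [IsIdempotentElem, e, this]
  have hcomm : ∀ h, Commute (ρ.tprod ρ h) e := fun h => by
    refine Commute.smul_right (Commute.sub_right (Commute.one_right _) ?_) _
    refine TensorProduct.ext' fun x y => ?_
    simp [τ]
  refine ⟨_, trace_mul_mem_charRing_of_isIdempotentElem (ρ.tprod ρ) he hcomm g, ?_⟩
  have h1 : trace ℂ _ (ρ.tprod ρ g) = ρ.character g ^ 2 := by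
    rw [sq]
    exact congrFun (char_tensor ρ ρ) g
  have h2 : trace ℂ _ (ρ.tprod ρ g * τ) = ρ.character (g ^ 2) := by
    rw [character, sq, map_mul ρ]
    exact trace_map_comp_comm (ρ g)
  rw [mul_smul_comm, mul_sub, mul_one, map_smul, map_sub, h1, h2, smul_eq_mul]
  ring

end Representation

theorem exists_isCyclotomicExtension_rat {n : ℕ} (hn : n ≠ 0) :
    ∃ (K : Type) (_ : Field K) (_ : Algebra ℚ K), IsCyclotomicExtension {n} ℚ K := by
  have : NeZero n := ⟨hn⟩
  exact ⟨CyclotomicField n ℚ, inferInstance, CyclotomicField.algebra n ℚ,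
    CyclotomicField.isCyclotomicExtension n ℚ⟩

section FiniteGroup

variable {G : Type} [Group G] [Finite G]

theorem exists_eq_sum_of_mem_charValues {z : ℂ} (hz : z ∈ charValues G) :
    ∃ (s : Finset ℂ) (d : ℂ → ℕ), (∀ μ ∈ s, μ ^ Nat.card G = 1) ∧ z = ∑ μ ∈ s, (d μ : ℂ) * μ := by
  obtain ⟨V, -, g, rfl⟩ := hz
  obtain ⟨s, d, hs, h⟩ := LinearMap.exists_trace_pow_eq_sum (V.ρ g) (Nat.card_pos (α := G)).ne'
    (by rw [← map_pow, pow_card_eq_one', map_one])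
  have h1 := h 1
  simp only [pow_one] at h1
  exact ⟨s, d, hs, h1⟩

theorem charRing_le_integralClosure : charRing G ≤ (integralClosure ℤ ℂ).toSubring := by
  refine Subring.closure_le.2 fun z hz => ?_
  obtain ⟨s, d, hs, rfl⟩ := exists_eq_sum_of_mem_charValues hz
  exact IsIntegral.sum _ fun μ hμ => (isIntegral_algebraMap (R := ℤ) (x := (d μ : ℤ))).mul
    (IsIntegral.of_pow Nat.card_pos (by rw [hs μ hμ]; exact isIntegral_one))

theorem module_finite_ringOfIntIn_charField :
    Module.Finite ℤ (ringOfIntIn (charField G)).toAddSubgroup := by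
  obtain ⟨K, _, _, _⟩ := exists_isCyclotomicExtension_rat (Nat.card_pos (α := G)).ne'
  have : NeZero (Nat.card G) := ⟨Nat.card_pos.ne'⟩
  have := algebraRat.charZero K
  have := IsCyclotomicExtension.finiteDimensional {Nat.card G} ℚ K
  have := IsCyclotomicExtension.numberField {Nat.card G} ℚ K
  let φ : K →ₐ[ℚ] ℂ := IsAlgClosed.lift
  have hζ : IsPrimitiveRoot (φ (IsCyclotomicExtension.zeta (Nat.card G) ℚ K)) (Nat.card G) :=
    (IsCyclotomicExtension.zeta_spec (Nat.card G) ℚ _).map_of_injective φ.injective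
  have hK : charField G ≤ φ.fieldRange.toSubfield := by
    refine Subfield.closure_le.2 fun z hz => ?_
    obtain ⟨s, d, hs, rfl⟩ := exists_eq_sum_of_mem_charValues hz
    refine sum_mem fun μ hμ => mul_mem (natCast_mem _ _) ?_
    obtain ⟨i, -, rfl⟩ := hζ.eq_pow_of_pow_eq_one (hs μ hμ)
    exact ⟨_ ^ i, map_pow φ _ i⟩
  let f : NumberField.RingOfIntegers K →+ ℂ :=
    (φ : K →+ ℂ).comp (algebraMap (NumberField.RingOfIntegers K) K : _ →+ K)
  have hf : (ringOfIntIn (charField G)).toAddSubgroup ≤ f.range := by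
    rintro x ⟨hx, hxK⟩
    obtain ⟨y, rfl⟩ := hK hxK
    exact ⟨⟨y, (isIntegral_algHom_iff (φ.restrictScalars ℤ) φ.injective).1 hx⟩, rfl⟩
  have : Module.Finite ℤ f.range :=
    Module.Finite.of_surjective f.rangeRestrict.toIntLinearMap f.rangeRestrict_surjective
  exact Module.Finite.of_injective (AddSubgroup.inclusion hf).toIntLinearMap
    (AddSubgroup.inclusion_injective hf)

theorem exists_int_mul_mem_charRing {x : ℂ} (hx : x ∈ charField G) :
    ∃ N : ℤ, N ≠ 0 ∧ N * x ∈ charRing G := by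
  obtain ⟨a, ha, b, hb, rfl⟩ := Subfield.mem_closure_iff.1 hx
  rcases eq_or_ne b 0 with rfl | hb0
  · exact ⟨1, one_ne_zero, by simp⟩
  have hint : IsIntegral ℤ b := charRing_le_integralClosure hb
  obtain ⟨p, hp0, hp⟩ := hint.isAlgebraic.exists_nonzero_coeff_and_aeval_eq_zero
    (mem_nonZeroDivisors_of_ne_zero hb0)
  refine ⟨p.coeff 0, hp0, ?_⟩
  have hdiv : Polynomial.aeval b p.divX ∈ charRing G := by
    rw [Polynomial.aeval_eq_sum_range]
    exact sum_mem fun i _ => zsmul_mem (pow_mem hb i) _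
  rw [← Polynomial.divX_mul_X_add p] at hp
  simp only [map_add, map_mul, Polynomial.aeval_X, Polynomial.aeval_C] at hp
  have : ((p.coeff 0 : ℤ) : ℂ) * (a / b) =
      -(Polynomial.aeval b p.divX * a) := by
    rw [show ((p.coeff 0 : ℤ) : ℂ) = _ from eq_neg_of_add_eq_zero_right hp]
    field_simp
  rw [this]
  exact neg_mem (mul_mem hdiv ha)

theorem finite_charQuot : Finite (charQuot G) := by
  unfold charQuot
  have := module_finite_ringOfIntIn_charField (G := G)
  have : AddGroup.FG (ringOfIntIn (charField G)).toAddSubgroup :=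
    Module.Finite.iff_addGroup_fg.1 this
  refine AddCommGroup.finite_of_fg_isAddTorsion _ fun q => ?_
  induction q using QuotientAddGroup.induction_on with
  | H x =>
  obtain ⟨N, hN, hx⟩ := exists_int_mul_mem_charRing x.2.2
  rw [isOfFinAddOrder_iff_zsmul_eq_zero]
  refine ⟨N, hN, ?_⟩
  rw [← QuotientAddGroup.mk_zsmul, QuotientAddGroup.eq_zero_iff, AddSubgroup.mem_addSubgroupOf]
  simpa using hx

/-- If a power of Frobenius of large exponent acts trivially on the character values modulo `2`,
then `ℤ[G]` modulo `2` is reduced, hence `ℤ[G]` is maximal at `2`. -/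
theorem odd_card_charQuot_of_frobenius
    (h : ∀ T, ∃ k ≥ T, ∀ z ∈ charValues G, ∃ r ∈ charRing G, z ^ 2 ^ k - z = 2 * r) :
    Odd (Nat.card (charQuot G)) := by
  have hfrob : ∀ k, (∀ z ∈ charValues G, ∃ r ∈ charRing G, z ^ 2 ^ k - z = 2 * r) →
      ∀ z ∈ charRing G, ∃ r ∈ charRing G, z ^ 2 ^ k - z = 2 * r := by
    intro k hk z hz
    induction hz using Subring.closure_induction with
    | mem z hz => exact hk z hz
    | zero => exact ⟨0, zero_mem _, by simp⟩
    | one => exact ⟨0, zero_mem _, by simp⟩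
    | add x y hx hy ihx ihy =>
      obtain ⟨r, hr, hxr⟩ := ihx
      obtain ⟨r', hr', hyr⟩ := ihy
      obtain ⟨c, hc⟩ := exists_add_pow_prime_pow_eq Nat.prime_two
        (⟨x, hx⟩ : charRing G) ⟨y, hy⟩ k
      have hc := congrArg Subtype.val hc
      change (x + y) ^ 2 ^ k = x ^ 2 ^ k + y ^ 2 ^ k + ((2 : ℕ) : ℂ) * x * y * c at hc
      push_cast at hc
      exact ⟨r + r' + x * y * c, add_mem (add_mem hr hr') (mul_mem (mul_mem hx hy) c.2), by
        rw [hc]; linear_combination hxr + hyr⟩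
    | neg x hx ih =>
      obtain ⟨r, hr, hxr⟩ := ih
      rcases Nat.eq_zero_or_pos k with rfl | hk
      · exact ⟨0, zero_mem _, by simp⟩
      · refine ⟨r + x, add_mem hr hx, ?_⟩
        rw [(even_two.pow_of_ne_zero hk.ne').neg_pow]
        linear_combination hxr
    | mul x y hx hy ihx ihy =>
      obtain ⟨r, hr, hxr⟩ := ihx
      obtain ⟨r', hr', hyr⟩ := ihy
      exact ⟨r * y ^ 2 ^ k + x * r',
        add_mem (mul_mem hr (pow_mem hy _)) (mul_mem hx hr'), by
        rw [mul_pow]; linear_combination y ^ 2 ^ k * hxr + x * hyr⟩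
  have hfin := finite_charQuot (G := G)
  unfold charQuot at hfin ⊢
  set O := ringOfIntIn (charField G)
  set Q := O.toAddSubgroup ⧸ (charRing G).toAddSubgroup.addSubgroupOf O.toAddSubgroup
  by_contra hodd
  rw [Nat.not_odd_iff_even, even_iff_two_dvd] at hodd
  have : Fact (Nat.Prime 2) := ⟨Nat.prime_two⟩
  obtain ⟨q, hq⟩ := exists_prime_addOrderOf_dvd_card' (G := Q) 2 hodd
  obtain ⟨x, rfl⟩ := QuotientAddGroup.mk_surjective q
  have hx : (x : ℂ) ∉ charRing G := fun hx => by
    rw [(QuotientAddGroup.eq_zero_iff x).2 hx, addOrderOf_zero] at hq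
    omega
  have hsmul : ∀ (N : ℕ) (y : O.toAddSubgroup), N • (y : Q) = 0 → (N : ℂ) * y ∈ charRing G := by
    intro N y hy
    rw [← QuotientAddGroup.mk_nsmul, QuotientAddGroup.eq_zero_iff,
      AddSubgroup.mem_addSubgroupOf] at hy
    simpa using hy
  have h2x := hsmul 2 x (by rw [← hq]; exact addOrderOf_nsmul_eq_zero _)
  obtain ⟨a, b, ⟨c, rfl⟩, hab⟩ := Nat.exists_eq_two_pow_mul_odd (Nat.card_pos (α := Q)).ne'
  obtain ⟨k, hk, hz⟩ := h a
  obtain ⟨r, hr, hxr⟩ := hfrob k hz _ h2x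
  have hxk := hsmul (Nat.card Q) ⟨(x : ℂ) ^ 2 ^ k, pow_mem (show (x : ℂ) ∈ O from x.2) _⟩
    card_nsmul_eq_zero'
  rw [hab] at hxk
  push_cast at hxk hxr h2x
  obtain ⟨e, he⟩ := Nat.exists_eq_add_of_lt (hk.trans_lt Nat.lt_two_pow_self)
  have hbx : (x : ℂ) =
      2 ^ e * (2 ^ a * (2 * c + 1) * x ^ 2 ^ k) - (2 * c + 1) * r - c * (2 * x) := by
    have : (2 : ℂ) * (2 ^ e * 2 ^ a * x ^ 2 ^ k) = 2 * (x + r) := by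
      rw [mul_pow] at hxr
      have hpow : (2 : ℂ) ^ 2 ^ k = 2 * 2 ^ e * 2 ^ a := by rw [he]; ring
      rw [hpow] at hxr
      linear_combination hxr
    have := mul_left_cancel₀ two_ne_zero this
    linear_combination -(2 * (c : ℂ) + 1) * this
  refine hx (hbx ▸ ?_)
  have h2 : (2 : ℂ) ∈ charRing G := ofNat_mem _ 2
  exact sub_mem (sub_mem (mul_mem (pow_mem h2 e) hxk)
    (mul_mem (add_mem (mul_mem h2 (natCast_mem _ c)) (one_mem _)) hr))
    (mul_mem (natCast_mem _ c) h2x)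

theorem FDRep.exists_character_pow_sub_eq (V : FDRep ℂ G) (g : G) (k : ℕ) :
    ∃ r ∈ charRing G, V.character g ^ 2 ^ k - V.character (g ^ 2 ^ k) = 2 * r := by
  induction k with
  | zero => exact ⟨0, zero_mem _, by simp⟩
  | succ k ih =>
    obtain ⟨r, hr, h⟩ := ih
    obtain ⟨r', hr', h'⟩ := Representation.exists_character_sq_sub_eq V.ρ (g ^ 2 ^ k)
    have hmem : V.character (g ^ 2 ^ k) ∈ charRing G :=
      Representation.character_mem_charRing V.ρ _
    have h2 : (2 : ℂ) ∈ charRing G := ofNat_mem _ 2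
    change V.character (g ^ 2 ^ k) ^ 2 - V.character ((g ^ 2 ^ k) ^ 2) = 2 * r' at h'
    rw [← pow_mul, ← pow_succ] at h'
    refine ⟨2 * r * V.character (g ^ 2 ^ k) + 2 * r * r + r', add_mem (add_mem
      (mul_mem (mul_mem h2 hr) hmem) (mul_mem (mul_mem h2 hr) hr)) hr', ?_⟩
    rw [pow_succ 2 k, pow_mul, eq_add_of_sub_eq h, ← pow_succ]
    linear_combination h'

theorem FDRep.exists_int_eq_character (V : FDRep ℂ G) (g : G)
    (hg : ∀ j : ℕ, j.Coprime (orderOf g) → IsConj g (g ^ j)) : ∃ a : ℤ, V.character g = a := by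
  have hm := (orderOf_pos g).ne'
  obtain ⟨s, d, hs, h⟩ := LinearMap.exists_trace_pow_eq_sum (V.ρ g) hm
    (by rw [← map_pow, pow_orderOf_eq_one, map_one])
  have : NeZero (orderOf g) := ⟨hm⟩
  obtain ⟨K, _, _, _⟩ := exists_isCyclotomicExtension_rat hm
  have := IsCyclotomicExtension.finiteDimensional {orderOf g} ℚ K
  have hchar : ∀ j, V.character (g ^ j) = ∑ μ ∈ s, (d μ : ℂ) * μ ^ j := fun j => by
    rw [← h, ← map_pow]; rfl
  have h1 : V.character g = ∑ μ ∈ s, (d μ : ℂ) * μ := by simpa using hchar 1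
  rw [h1]
  refine exists_int_eq_sum_of_forall_coprime hm K
    IsAlgClosed.lift hs fun j hj => ?_
  obtain ⟨c, hc⟩ := isConj_iff.1 (hg j hj)
  rw [← hchar, ← h1, ← hc, FDRep.char_conj]

end FiniteGroup

/-- For `G = Aₙ`, the order of `ℤ_{ℚ(G)}/ℤ[G]` is odd. -/
theorem odd_card_charQuot_alternating (n : ℕ) :
    Odd (Nat.card (charQuot (alternatingGroup (Fin n)))) := by
  refine odd_card_charQuot_of_frobenius fun T => ?_
  obtain ⟨a, m, hm, hcard⟩ :=
    Nat.exists_eq_two_pow_mul_odd (Nat.card_pos (α := alternatingGroup (Fin n))).ne'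
  have hpos : 0 < m.totient := Nat.totient_pos.2 hm.pos
  refine ⟨m.totient * (T + 1), by nlinarith, ?_⟩
  rintro _ ⟨V, -, g, rfl⟩
  rcases Nat.even_or_odd (orderOf g) with hg | hg
  · obtain ⟨z, hz⟩ := V.exists_int_eq_character g
      fun j hj => alternatingGroup.isConj_pow_of_coprime g hg hj
    have heven : Even (z ^ 2 ^ (m.totient * (T + 1)) - z) := by
      rw [Int.even_sub, Int.even_pow' (by positivity)]
    obtain ⟨r, hr⟩ := even_iff_two_dvd.1 heven
    exact ⟨r, intCast_mem _ r, by rw [hz]; exact_mod_cast hr⟩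
  · obtain ⟨r, hr, h⟩ := V.exists_character_pow_sub_eq g (m.totient * (T + 1))
    refine ⟨r, hr, ?_⟩
    have hdvd : orderOf g ∣ m := by
      refine (Nat.Coprime.pow_right a hg.coprime_two_right).dvd_of_dvd_mul_left ?_
      rw [← hcard]
      exact orderOf_dvd_natCard g
    have hmod : 2 ^ (m.totient * (T + 1)) ≡ 1 [MOD orderOf g] := by
      rw [pow_mul]
      simpa using ((Nat.ModEq.pow_totient hm.coprime_two_left).of_dvd hdvd).pow (T + 1)
    rwa [pow_eq_pow_iff_modEq.2 hmod, pow_one] at h
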